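/- arXiv:2505.09357 — 7 statements merged into one kernel-verified Lean document; each statement's English description precedes it below -/
import Mathlib

section
/- Let n ≥ 2 be an integer and let ζ_n = exp(2πi/n). For every integer m ≥ 1, the value 𝔷_n(ζ_n; m, 1) = ∑_{1≤i_1<⋯<i_m≤n−1} ∏_{j=1}^m (1−ζ_n^{i_j})^{−1} satisfies 𝔷_n(ζ_n; m, 1) = (1/(m+1))·C(n−1, m), where C(n−1,m) is the binomial coefficient. -/
/-- The primitive `n`-th root of unity `ζ_n = exp(2πi/n)`. -/
noncomputable def zetaN (n : ℕ) : ℂ := Complex.exp (2 * Real.pi * Complex.I / n)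

/-- The finite `q`-multiple zeta value `𝔷_n(ζ_n; m, s)`, the sum over strictly increasing
`m`-tuples `1 ≤ i₁ < ⋯ < i_m ≤ n-1` (equivalently, `m`-element subsets of `{1,…,n-1}`)
of `∏ 1/(1-ζ_n^{i_j})^s`. -/
noncomputable def zmzv (n m s : ℕ) : ℂ :=
  ∑ T ∈ (Finset.Icc 1 (n - 1)).powersetCard m,
    (∏ i ∈ T, (1 - zetaN n ^ i) ^ s)⁻¹

open Polynomial in
/-- The `m`-th coefficient of `∏ (1 + f i X)` is the `m`-th elementary symmetric sum of `f`. -/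
theorem coeff_prod_one_add_C_mul_X {ι R : Type*} [CommSemiring R] (s : Finset ι) (f : ι → R)
    (m : ℕ) :
    (∏ i ∈ s, (1 + C (f i) * X)).coeff m = ∑ T ∈ s.powersetCard m, ∏ i ∈ T, f i := by
  classical
  rw [Finset.prod_one_add, finsetSum_coeff, Finset.powersetCard_eq_filter,
    Finset.sum_filter]
  refine Finset.sum_congr rfl fun T _ => ?_
  rw [Finset.prod_mul_distrib, Finset.prod_const, ← map_prod, coeff_C_mul, coeff_X_pow]
  simp [eq_comm]

open Polynomial in
/-- The generating polynomial of the elementary symmetric sums of `1 / (1 - ζ ^ i)`. -/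
theorem IsPrimitiveRoot.natCast_mul_X_mul_prod_one_add {K : Type*} [Field K] {ζ : K} {k : ℕ}
    (hζ : IsPrimitiveRoot ζ (k + 1)) :
    C ((k : K) + 1) * (X * ∏ i ∈ Finset.Icc 1 k, (1 + C (1 - ζ ^ i)⁻¹ * X)) =
      (X + 1) ^ (k + 1) - 1 := by
  have hfactor : (X ^ (k + 1) - C 1 : K[X]) = ∏ i ∈ Finset.range (k + 1), (X - C (ζ ^ i * 1)) :=
    X_pow_sub_C_eq_prod hζ k.succ_pos (one_pow _)
  have hcomp := congrArg (fun p : K[X] => p.comp (X + 1)) hfactor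
  simp only [sub_comp, pow_comp, X_comp, C_comp, map_one, mul_one, prod_comp, one_comp] at hcomp
  rw [hcomp, Finset.prod_range_succ', ← hζ.prod_one_sub_pow_eq_order, map_prod,
    Finset.range_eq_Ico, ← Finset.Ico_add_one_right_eq_Icc,
    Finset.prod_Ico_add' (fun i => C (1 - ζ ^ i)) 0 k 1,
    Finset.prod_Ico_add' (fun i => (X + 1 - C (ζ ^ i) : K[X])) 0 k 1,
    mul_left_comm, ← Finset.prod_mul_distrib, zero_add, mul_comm]
  congr 1
  · refine Finset.prod_congr rfl fun i hi => ?_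
    rw [Finset.mem_Ico] at hi
    have hne : 1 - ζ ^ i ≠ 0 :=
      sub_ne_zero.mpr (hζ.pow_ne_one_of_pos_of_lt (by omega) hi.2).symm
    rw [mul_add, ← mul_assoc, ← C_mul, mul_inv_cancel₀ hne, C_sub, C_1]
    ring
  · simp

theorem stmt0 (n m : ℕ) (hn : 2 ≤ n) (hm : 1 ≤ m) :
    zmzv n m 1 = (1 / ((m : ℂ) + 1)) * ((n - 1).choose m : ℂ) := by
  obtain ⟨k, rfl⟩ : ∃ k, n = k + 1 := ⟨n - 1, by omega⟩
  have hζ : IsPrimitiveRoot (zetaN (k + 1)) (k + 1) :=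
    Complex.isPrimitiveRoot_exp (k + 1) k.succ_ne_zero
  have hcoeff := congrArg (fun p : Polynomial ℂ => p.coeff (m + 1))
    hζ.natCast_mul_X_mul_prod_one_add
  simp only [Polynomial.coeff_C_mul, Polynomial.coeff_X_mul, coeff_prod_one_add_C_mul_X,
    Polynomial.coeff_sub, Polynomial.coeff_X_add_one_pow, Polynomial.coeff_one,
    Nat.succ_ne_zero, if_false, sub_zero] at hcoeff
  have hchoose : ((k : ℂ) + 1) * (k.choose m : ℂ) = ((k + 1).choose (m + 1) : ℂ) * (m + 1) := by
    exact_mod_cast Nat.add_one_mul_choose_eq k m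
  have hk : (k : ℂ) + 1 ≠ 0 := Nat.cast_add_one_ne_zero k
  have hm' : (m : ℂ) + 1 ≠ 0 := Nat.cast_add_one_ne_zero m
  simp only [zmzv, pow_one, Nat.add_sub_cancel, ← Finset.prod_inv_distrib]
  apply mul_left_cancel₀ hk
  rw [hcoeff, mul_left_comm, hchoose]
  field_simp
end

section
/- Let n ≥ 2, m ≥ 1 and s ≥ 1 be integers and let ζ_n = exp(2πi/n). Let M be the m×m complex matrix whose (i,1) entry is i·𝔷_n(ζ_n; i, s) for 1 ≤ i ≤ m, whose (i,j) entry for 2 ≤ j ≤ i is 𝔷_n(ζ_n; i−j+1, s), whose (i,i+1) entry is 1, and whose remaining entries (j > i+1) are 0. Then 𝔷_n(ζ_n; 1, m·s) = det M. -/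
/-- The Newton identities for a finite family:
`(k + 1) * e_(k+1) = ∑_{j ≤ k} e_(k-j) * (-1)^j * p_(j+1)`. -/
theorem mul_sum_powersetCard_prod_eq_sum {ι R : Type*} [CommRing R] (S : Finset ι) (f : ι → R)
    (k : ℕ) :
    ((k : R) + 1) * ∑ T ∈ S.powersetCard (k + 1), ∏ i ∈ T, f i =
      ∑ j ∈ Finset.range (k + 1),
        (∑ T ∈ S.powersetCard (k - j), ∏ i ∈ T, f i) * ((-1) ^ j * ∑ i ∈ S, f i ^ (j + 1)) := by
  classical
  have esymm_eval : ∀ m, MvPolynomial.aeval (fun x : S => f x) (MvPolynomial.esymm S R m) =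
      ∑ T ∈ S.powersetCard m, ∏ i ∈ T, f i := by
    intro m
    rw [MvPolynomial.aeval_esymm_eq_multiset_esymm, ← Finset.esymm_map_val]
    congr 1
    exact Multiset.attach_map_val' S.val f
  have psum_eval : ∀ m, MvPolynomial.aeval (fun x : S => f x) (MvPolynomial.psum S R m) =
      ∑ i ∈ S, f i ^ m := by
    intro m
    simp only [MvPolynomial.psum, map_sum, map_pow, MvPolynomial.aeval_X]
    exact Finset.sum_coe_sort S fun i => f i ^ m
  have newton := congrArg (MvPolynomial.aeval fun x : S => f x)
    (MvPolynomial.mul_esymm_eq_sum S R (k + 1))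
  simp only [map_mul, map_natCast, map_sum, map_pow, map_neg, map_one, esymm_eval,
    Finset.sum_filter] at newton
  rw [Finset.Nat.sum_antidiagonal_eq_sum_range_succ_mk, Finset.sum_range_succ,
    ← Finset.sum_range_reflect] at newton
  push_cast at newton
  rw [newton, if_neg (lt_irrefl _), map_zero, add_zero, Finset.mul_sum]
  refine Finset.sum_congr rfl fun j hj => ?_
  have hjk : j ≤ k := Nat.lt_succ_iff.mp (Finset.mem_range.mp hj)
  have h_compl : k + 1 - (k - j) = j + 1 := by omega
  have h_sign : (-1 : R) ^ (k + 1 + 1) * (-1) ^ (k - j) = (-1) ^ j := by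
    obtain ⟨d, rfl⟩ := Nat.exists_eq_add_of_le hjk
    rw [Nat.add_sub_cancel_left, ← pow_add, show j + d + 1 + 1 + d = j + 2 * (d + 1) by ring,
      pow_add, pow_mul]
    simp
  rw [h_compl, if_pos (by omega), ← h_sign]
  simp only [map_mul, map_pow, map_neg, map_one, esymm_eval, psum_eval]
  ring

/-- If `b` is the convolution of `e` (with `e 0 = 1`) and `x`, the last coordinate of `x` is,
up to sign, the Hessenberg determinant with first column `b` and Toeplitz entries `e`. -/
theorem det_hessenberg_toeplitz_eq {R : Type*} [CommRing R] (e x b : ℕ → R) (he : e 0 = 1)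
    (hb : ∀ k, b k = ∑ j ∈ Finset.range (k + 1), e (k - j) * x j) (k : ℕ) :
    Matrix.det (Matrix.of fun i j : Fin (k + 1) =>
      if j.1 = 0 then b i.1
      else if j.1 ≤ i.1 then e (i.1 - j.1 + 1)
      else if j.1 = i.1 + 1 then 1 else 0) = (-1) ^ k * x k := by
  set M : Matrix (Fin (k + 1)) (Fin (k + 1)) R := Matrix.of fun i j =>
    if j.1 = 0 then b i.1
    else if j.1 ≤ i.1 then e (i.1 - j.1 + 1)
    else if j.1 = i.1 + 1 then 1 else 0 with hM
  set A : Matrix (Fin (k + 1)) (Fin (k + 1)) R := Matrix.of fun i j =>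
    if j.1 ≤ i.1 then e (i.1 - j.1) else 0 with hA
  have det_A : A.det = 1 := by
    rw [Matrix.det_of_isLowerTriangular]
    · simp [hA, he]
    · intro i j hij
      have : i.1 < j.1 := hij
      simp only [hA, Matrix.of_apply, if_neg this.not_ge]
  have mulVec_A : A.mulVec (fun j => x j.1) = fun i => b i.1 := by
    funext i
    simp only [Matrix.mulVec, dotProduct, hA, Matrix.of_apply, hb, ite_mul, zero_mul]
    rw [Fin.sum_univ_eq_sum_range (fun j => if j ≤ i.1 then e (i.1 - j) * x j else 0) (k + 1),
      ← Finset.sum_filter]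
    refine Finset.sum_congr ?_ fun _ _ => rfl
    ext j
    simp only [Finset.mem_filter, Finset.mem_range]
    omega
  have cramer_A : (A.updateCol (Fin.last k) fun i => b i.1).det = x k := by
    rw [← Matrix.cramer_apply, ← mulVec_A, Matrix.cramer_eq_adjugate_mulVec, Matrix.mulVec_mulVec,
      Matrix.adjugate_mul, det_A, one_smul, Matrix.one_mulVec, Fin.val_last]
  have rotate_M : M.submatrix id (finRotate (k + 1)) =
      A.updateCol (Fin.last k) fun i => b i.1 := by
    ext i j
    induction j using Fin.lastCases with
    | last => simp [hM]
    | cast j =>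
      rw [Matrix.updateCol_ne (Fin.castSucc_lt_last j).ne, Matrix.submatrix_apply, id,
        finRotate_apply, Fin.coeSucc_eq_succ]
      simp only [hM, hA, Matrix.of_apply, Fin.val_succ, Fin.val_castSucc]
      rcases lt_trichotomy j.1 i.1 with h | h | h
      · rw [if_neg (by omega), if_pos (by omega), if_pos h.le]
        congr 1
        omega
      · simp [h, he]
      · rw [if_neg (by omega), if_neg (by omega), if_neg (by omega), if_neg (by omega)]
  rw [← cramer_A, ← rotate_M, Matrix.det_permute', sign_finRotate, ← mul_assoc]
  simp [← mul_pow]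

/-- The value `𝔷_n(ζ_n; m, s)` is an elementary symmetric sum of inverse powers. -/
theorem zmzv_eq_sum_prod (n m s : ℕ) :
    zmzv n m s = ∑ T ∈ (Finset.Icc 1 (n - 1)).powersetCard m,
      ∏ i ∈ T, ((1 - zetaN n ^ i) ^ s)⁻¹ := by
  simp only [zmzv, Finset.prod_inv_distrib]

/-- The value `𝔷_n(ζ_n; 1, m * s)` is a power sum of inverse `s`-th powers. -/
theorem zmzv_one_mul (n m s : ℕ) :
    zmzv n 1 (m * s) = ∑ i ∈ Finset.Icc 1 (n - 1), ((1 - zetaN n ^ i) ^ s)⁻¹ ^ m := by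
  simp [zmzv, Finset.powersetCard_one, ← pow_mul, mul_comm]

theorem stmt3 (n m s : ℕ) (hn : 2 ≤ n) (hm : 1 ≤ m) (hs : 1 ≤ s) :
    zmzv n 1 (m * s) =
      Matrix.det (Matrix.of fun i j : Fin m =>
        if j.1 = 0 then ((i.1 : ℂ) + 1) * zmzv n (i.1 + 1) s
        else if j.1 ≤ i.1 then zmzv n (i.1 - j.1 + 1) s
        else if j.1 = i.1 + 1 then 1 else 0) := by
  obtain ⟨k, rfl⟩ := Nat.exists_eq_add_of_le' hm
  rw [det_hessenberg_toeplitz_eq (fun i => zmzv n i s)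
    (fun j => (-1) ^ j * zmzv n 1 ((j + 1) * s)) (fun i => ((i : ℂ) + 1) * zmzv n (i + 1) s)
    (by simp [zmzv]) ?_ k]
  · rw [← mul_assoc, ← mul_pow]
    simp
  · intro i
    simp only [zmzv_one_mul, zmzv_eq_sum_prod n _ s]
    exact mul_sum_powersetCard_prod_eq_sum _ _ i
end

section
/- Let n ≥ 2 be an integer and let ζ_n = exp(2πi/n). Then 𝔷_n(ζ_n; 1, 2) = ∑_{i=1}^{n−1} 1/(1−ζ_n^{i})^{2} = −(n−1)(n−5)/12. -/
theorem sum_range_sq_mul_pow_mul {R : Type*} [CommRing R] (x : R) (m : ℕ) :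
    (1 - x) ^ 3 * ∑ k ∈ Finset.range m, (k : R) ^ 2 * x ^ k =
      x + x ^ 2 - m ^ 2 * x ^ m + (2 * m ^ 2 - 2 * m - 1) * x ^ (m + 1)
        - (m - 1) ^ 2 * x ^ (m + 2) := by
  induction m with
  | zero => simp
  | succ m ih => rw [Finset.sum_range_succ, mul_add, ih]; push_cast; ring

theorem sum_range_mul_pow_mul {R : Type*} [CommRing R] (x : R) (m : ℕ) :
    (1 - x) ^ 2 * ∑ k ∈ Finset.range m, (k : R) * x ^ k =
      x - m * x ^ m + (m - 1) * x ^ (m + 1) := by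
  induction m with
  | zero => simp
  | succ m ih => rw [Finset.sum_range_succ, mul_add, ih]; push_cast; ring

/-- The discrete Fourier expansion of `(1 - x)⁻²` at a nontrivial `n`-th root of unity. -/
theorem inv_one_sub_sq_eq_sum {K : Type*} [Field K] [CharZero K] {n : ℕ} (hn : n ≠ 0) {x : K}
    (hx : x ^ n = 1) (hx1 : x ≠ 1) :
    ((1 - x) ^ 2)⁻¹ =
      ∑ k ∈ Finset.range n, (((n : K) - 2) * k - (k : K) ^ 2) / (2 * n) * x ^ k := by
  have hsub : 1 - x ≠ 0 := sub_ne_zero.mpr hx1.symm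
  have hnK : (n : K) ≠ 0 := Nat.cast_ne_zero.mpr hn
  have hlin := sum_range_mul_pow_mul x n
  have hquad := sum_range_sq_mul_pow_mul x n
  have hsum : ∑ k ∈ Finset.range n, (((n : K) - 2) * k - (k : K) ^ 2) / (2 * n) * x ^ k =
      (((n : K) - 2) * ∑ k ∈ Finset.range n, (k : K) * x ^ k
        - ∑ k ∈ Finset.range n, (k : K) ^ 2 * x ^ k) / (2 * n) := by
    rw [Finset.mul_sum, ← Finset.sum_sub_distrib, Finset.sum_div]
    exact Finset.sum_congr rfl fun k _ => by ring
  rw [pow_add, hx] at hlin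
  rw [pow_add, pow_add, hx] at hquad
  rw [hsum]
  apply inv_eq_of_mul_eq_one_right
  rw [← mul_div_assoc, div_eq_one_iff_eq (by simp [hnK])]
  apply mul_left_cancel₀ hsub
  linear_combination ((n : K) - 2) * (1 - x) * hlin - hquad

/-- The sum of the `k`-th powers of the nontrivial `n`-th roots of unity, for `0 < k < n`. -/
theorem IsPrimitiveRoot.sum_Icc_pow_pow {K : Type*} [Field K] {n : ℕ} {ζ : K}
    (h : IsPrimitiveRoot ζ n) {k : ℕ} (hk0 : k ≠ 0) (hkn : k < n) :
    ∑ i ∈ Finset.Icc 1 (n - 1), (ζ ^ i) ^ k = -1 := by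
  have hne : ζ ^ k - 1 ≠ 0 := sub_ne_zero.mpr (h.pow_ne_one_of_pos_of_lt hk0 hkn)
  have hgeom : ∑ i ∈ Finset.range n, (ζ ^ k) ^ i = 0 := by
    apply mul_left_cancel₀ hne
    rw [mul_geom_sum, ← pow_mul, mul_comm k n, pow_mul, h.pow_eq_one]
    simp
  obtain ⟨m, rfl⟩ : ∃ m, n = m + 1 := ⟨n - 1, by omega⟩
  rw [Finset.range_eq_Ico, Finset.sum_eq_sum_Ico_succ_bot (Nat.succ_pos m), pow_zero] at hgeom
  have hIcc : Finset.Icc 1 (m + 1 - 1) = Finset.Ico (0 + 1) (m + 1) := by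
    ext i; simp
  rw [hIcc, ← add_eq_zero_iff_eq_neg', ← hgeom]
  simp only [← pow_mul, mul_comm]

theorem sum_range_linear_sub_sq {K : Type*} [Field K] [CharZero K] (c : K) (n : ℕ) :
    ∑ k ∈ Finset.range n, (c * k - (k : K) ^ 2) =
      c * (n * (n - 1) / 2) - n * (n - 1) * (2 * n - 1) / 6 := by
  induction n with
  | zero => simp
  | succ n ih => rw [Finset.sum_range_succ, ih]; push_cast; field_simp; ring

theorem IsPrimitiveRoot.sum_inv_one_sub_pow_sq {K : Type*} [Field K] [CharZero K] {n : ℕ}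
    (hn : n ≠ 0) {ζ : K} (h : IsPrimitiveRoot ζ n) :
    ∑ i ∈ Finset.Icc 1 (n - 1), ((1 - ζ ^ i) ^ 2)⁻¹ =
      -(((n : K) - 1) * ((n : K) - 5)) / 12 := by
  have hnK : (n : K) ≠ 0 := Nat.cast_ne_zero.mpr hn
  have hexpand : ∀ i ∈ Finset.Icc 1 (n - 1), ((1 - ζ ^ i) ^ 2)⁻¹ =
      ∑ k ∈ Finset.range n, (((n : K) - 2) * k - (k : K) ^ 2) / (2 * n) * (ζ ^ i) ^ k := by
    intro i hi
    rw [Finset.mem_Icc] at hi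
    refine inv_one_sub_sq_eq_sum hn ?_ (h.pow_ne_one_of_pos_of_lt (by omega) (by omega))
    rw [← pow_mul, mul_comm, pow_mul, h.pow_eq_one, one_pow]
  have hinner : ∀ k ∈ Finset.range n,
      ∑ i ∈ Finset.Icc 1 (n - 1),
        (((n : K) - 2) * k - (k : K) ^ 2) / (2 * n) * (ζ ^ i) ^ k =
      (((n : K) - 2) * k - (k : K) ^ 2) * (-1 / (2 * n)) := by
    intro k hk
    rcases eq_or_ne k 0 with rfl | hk0
    · simp
    · rw [← Finset.mul_sum, h.sum_Icc_pow_pow hk0 (Finset.mem_range.mp hk)]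
      ring
  rw [Finset.sum_congr rfl hexpand, Finset.sum_comm, Finset.sum_congr rfl hinner,
    ← Finset.sum_mul, sum_range_linear_sub_sq]
  field_simp
  ring

theorem stmt5 (n : ℕ) (hn : 2 ≤ n) :
    zmzv n 1 2 = ∑ i ∈ Finset.Icc 1 (n - 1), ((1 - zetaN n ^ i) ^ 2)⁻¹ ∧
    ∑ i ∈ Finset.Icc 1 (n - 1), ((1 - zetaN n ^ i) ^ 2)⁻¹ =
      -(((n : ℂ) - 1) * ((n : ℂ) - 5)) / 12 := by
  have hn0 : n ≠ 0 := by omega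
  refine ⟨?_, (Complex.isPrimitiveRoot_exp n hn0).sum_inv_one_sub_pow_sq hn0⟩
  simp [zmzv, Finset.powersetCard_one]
end

section
/- Let n ≥ 2 be an integer and let ζ_n = exp(2πi/n). Then 𝔷_n(ζ_n; 1, 3) = ∑_{i=1}^{n−1} 1/(1−ζ_n^{i})^{3} = −(n−1)(n−3)/8. -/
theorem zetaN_isPrimitiveRoot (n : ℕ) (hn : n ≠ 0) : IsPrimitiveRoot (zetaN n) n :=
  Complex.isPrimitiveRoot_exp n hn

theorem geom_sum_eq_zero_of_pow_eq_one {n : ℕ} {z : ℂ} (hz : z ≠ 1) (hzn : z ^ n = 1) :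
    ∑ k ∈ Finset.range n, z ^ k = 0 := by
  rw [geom_sum_eq hz, hzn, sub_self, zero_div]

theorem sum_Icc_eq_sum_range_sub {n : ℕ} (hn : 2 ≤ n) (f : ℕ → ℂ) :
    ∑ i ∈ Finset.Icc 1 (n - 1), f i = ∑ i ∈ Finset.range n, f i - f 0 := by
  have h : Finset.Icc 1 (n - 1) = Finset.Ico 1 n := by
    ext i
    simp only [Finset.mem_Icc, Finset.mem_Ico]
    omega
  rw [h, Finset.range_eq_Ico, Finset.sum_eq_sum_Ico_succ_bot (by omega : 0 < n)]
  ring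

/-- Orthogonality: summing a polynomial `∑ q k * z ^ k` without constant term over the nontrivial
`n`-th roots of unity gives minus its value at `1`. -/
theorem sum_nontrivial_roots {n : ℕ} (hn : 2 ≤ n) (q : ℕ → ℂ) (hq : q 0 = 0) :
    ∑ i ∈ Finset.Icc 1 (n - 1), ∑ k ∈ Finset.range n, q k * (zetaN n ^ i) ^ k =
      -∑ k ∈ Finset.range n, q k := by
  have hprim := zetaN_isPrimitiveRoot n (by omega)
  rw [Finset.sum_comm, ← Finset.sum_neg_distrib]
  refine Finset.sum_congr rfl fun k hk => ?_
  rw [← Finset.mul_sum]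
  rcases Nat.eq_zero_or_pos k with rfl | hpos
  · simp [hq]
  · have hne : zetaN n ^ k ≠ 1 :=
      hprim.pow_ne_one_of_pos_of_lt hpos.ne' (Finset.mem_range.mp hk)
    have hpow : (zetaN n ^ k) ^ n = 1 := by
      rw [← pow_mul, mul_comm, pow_mul, hprim.pow_eq_one, one_pow]
    rw [sum_Icc_eq_sum_range_sub hn]
    simp only [← pow_mul, mul_comm _ k]
    simp only [pow_mul]
    rw [geom_sum_eq_zero_of_pow_eq_one hne hpow]
    simp

/-- Summation by parts for `∑ k z ^ k`. -/
theorem sub_one_mul_sum_id (z : ℂ) (n : ℕ) :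
    (z - 1) * ∑ k ∈ Finset.range n, (k : ℂ) * z ^ k =
      n * z ^ n - z * ∑ k ∈ Finset.range n, z ^ k := by
  induction n with
  | zero => simp
  | succ n ih =>
    rw [Finset.sum_range_succ, Finset.sum_range_succ, mul_add, ih]
    push_cast
    ring

/-- Summation by parts for `∑ k ^ 2 z ^ k`. -/
theorem sub_one_mul_sum_sq (z : ℂ) (n : ℕ) :
    (z - 1) * ∑ k ∈ Finset.range n, (k : ℂ) ^ 2 * z ^ k =
      n ^ 2 * z ^ n - z * (2 * ∑ k ∈ Finset.range n, (k : ℂ) * z ^ k +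
        ∑ k ∈ Finset.range n, z ^ k) := by
  induction n with
  | zero => simp
  | succ n ih =>
    rw [Finset.sum_range_succ, Finset.sum_range_succ, Finset.sum_range_succ, mul_add, ih]
    push_cast
    ring

/-- Summation by parts for `∑ k ^ 3 z ^ k`. -/
theorem sub_one_mul_sum_cube (z : ℂ) (n : ℕ) :
    (z - 1) * ∑ k ∈ Finset.range n, (k : ℂ) ^ 3 * z ^ k =
      n ^ 3 * z ^ n - z * (3 * ∑ k ∈ Finset.range n, (k : ℂ) ^ 2 * z ^ k +
        3 * ∑ k ∈ Finset.range n, (k : ℂ) * z ^ k + ∑ k ∈ Finset.range n, z ^ k) := by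
  induction n with
  | zero => simp
  | succ n ih =>
    rw [Finset.sum_range_succ, Finset.sum_range_succ, Finset.sum_range_succ,
      Finset.sum_range_succ, mul_add, ih]
    push_cast
    ring

/-- Coefficients, scaled by `-12 * n`, of a polynomial of degree less than `n` that represents
`((1 - z) ^ 3)⁻¹` at the nontrivial `n`-th roots of unity `z`. -/
noncomputable def invCubeCoeff (n k : ℕ) : ℂ :=
  2 * (k : ℂ) ^ 3 + (9 - 3 * n) * (k : ℂ) ^ 2 + (n ^ 2 - 9 * n + 12) * k

theorem sum_invCubeCoeff_mul_pow {n : ℕ} {z : ℂ} (hz : z ≠ 1) (hzn : z ^ n = 1) :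
    ∑ k ∈ Finset.range n, invCubeCoeff n k * z ^ k = -12 * n * ((1 - z) ^ 3)⁻¹ := by
  have h1 := sub_one_mul_sum_id z n
  have h2 := sub_one_mul_sum_sq z n
  have h3 := sub_one_mul_sum_cube z n
  rw [geom_sum_eq_zero_of_pow_eq_one hz hzn, hzn] at h1 h2 h3
  have hsplit : ∑ k ∈ Finset.range n, invCubeCoeff n k * z ^ k =
      2 * ∑ k ∈ Finset.range n, (k : ℂ) ^ 3 * z ^ k +
      (9 - 3 * n) * ∑ k ∈ Finset.range n, (k : ℂ) ^ 2 * z ^ k +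
      (n ^ 2 - 9 * n + 12) * ∑ k ∈ Finset.range n, (k : ℂ) * z ^ k := by
    simp only [Finset.mul_sum, ← Finset.sum_add_distrib]
    refine Finset.sum_congr rfl fun k _ => ?_
    rw [invCubeCoeff]
    ring
  rw [hsplit]
  generalize ∑ k ∈ Finset.range n, (k : ℂ) ^ 3 * z ^ k = a₃ at *
  generalize ∑ k ∈ Finset.range n, (k : ℂ) ^ 2 * z ^ k = a₂ at *
  generalize ∑ k ∈ Finset.range n, (k : ℂ) * z ^ k = a₁ at *
  have hz1 : z - 1 ≠ 0 := sub_ne_zero.mpr hz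
  have hz2 : 1 - z ≠ 0 := sub_ne_zero.mpr hz.symm
  rw [← div_eq_mul_inv, eq_div_iff (pow_ne_zero 3 hz2)]
  have e1 : a₁ = n / (z - 1) := by
    rw [eq_div_iff hz1]
    linear_combination h1
  have e2 : a₂ = (n ^ 2 - 2 * z * a₁) / (z - 1) := by
    rw [eq_div_iff hz1]
    linear_combination h2
  have e3 : a₃ = (n ^ 3 - z * (3 * a₂ + 3 * a₁)) / (z - 1) := by
    rw [eq_div_iff hz1]
    linear_combination h3
  rw [e3, e2, e1]
  field_simp
  ring

theorem sum_range_invCubeCoeff (n : ℕ) :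
    ∑ k ∈ Finset.range n, invCubeCoeff n k = -(3 * n * (n - 1) * (n - 3)) / 2 := by
  have h (c : ℂ) (m : ℕ) : ∑ k ∈ Finset.range m,
      (2 * (k : ℂ) ^ 3 + (9 - 3 * c) * (k : ℂ) ^ 2 + (c ^ 2 - 9 * c + 12) * k) =
      (m * (m - 1)) ^ 2 / 2 + (9 - 3 * c) * (m * (m - 1) * (2 * m - 1) / 6) +
        (c ^ 2 - 9 * c + 12) * (m * (m - 1) / 2) := by
    induction m with
    | zero => simp
    | succ m ih =>
      rw [Finset.sum_range_succ, ih]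
      push_cast
      ring
  simp only [invCubeCoeff]
  rw [h]
  ring

theorem stmt6 (n : ℕ) (hn : 2 ≤ n) :
    zmzv n 1 3 = ∑ i ∈ Finset.Icc 1 (n - 1), ((1 - zetaN n ^ i) ^ 3)⁻¹ ∧
    ∑ i ∈ Finset.Icc 1 (n - 1), ((1 - zetaN n ^ i) ^ 3)⁻¹ =
      -(((n : ℂ) - 1) * ((n : ℂ) - 3)) / 8 := by
  constructor
  · simp [zmzv, Finset.powersetCard_one]
  · have hn0 : (n : ℂ) ≠ 0 := by
      exact_mod_cast (by omega : n ≠ 0)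
    have hprim := zetaN_isPrimitiveRoot n (by omega)
    have key := sum_nontrivial_roots hn (invCubeCoeff n) (by simp [invCubeCoeff])
    have hterm : ∀ i ∈ Finset.Icc 1 (n - 1),
        ∑ k ∈ Finset.range n, invCubeCoeff n k * (zetaN n ^ i) ^ k =
          -12 * n * ((1 - zetaN n ^ i) ^ 3)⁻¹ := by
      intro i hi
      rw [Finset.mem_Icc] at hi
      refine sum_invCubeCoeff_mul_pow
        (hprim.pow_ne_one_of_pos_of_lt (by omega) (by omega)) ?_
      rw [← pow_mul, mul_comm, pow_mul, hprim.pow_eq_one, one_pow]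
    rw [Finset.sum_congr rfl hterm, ← Finset.mul_sum, sum_range_invCubeCoeff] at key
    refine mul_left_cancel₀ (mul_ne_zero (by norm_num : (-12 : ℂ) ≠ 0) hn0) ?_
    rw [key]
    ring
end

section
/- Let n ≥ 2 be an integer and let ζ_n = exp(2πi/n). Then 𝔷_n(ζ_n; 1, 4) = ∑_{i=1}^{n−1} 1/(1−ζ_n^{i})^{4} = (n−1)(n^3+n^2−109n+251)/720. -/
open Finset in
/-- Multiplying the generating sum of binomial coefficients by `1 - w`, for `w` an `n`-th root
of unity, lowers the binomial index. -/
lemma one_sub_mul_sum_choose_mul_pow {n : ℕ} {w : ℂ} (hw : w ^ n = 1) (j : ℕ) :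
    (1 - w) * ∑ k ∈ range n, (k.choose (j + 1) : ℂ) * w ^ k =
      w * ∑ k ∈ range n, (k.choose j : ℂ) * w ^ k - n.choose (j + 1) := by
  have h := (sum_range_succ' (fun k => (k.choose (j + 1) : ℂ) * w ^ k) n).symm.trans
    (sum_range_succ _ n)
  have h' : ∑ k ∈ range n, ((k + 1).choose (j + 1) : ℂ) * w ^ (k + 1) =
      w * ∑ k ∈ range n, (k.choose j : ℂ) * w ^ k +
        w * ∑ k ∈ range n, (k.choose (j + 1) : ℂ) * w ^ k := by
    rw [mul_sum, mul_sum, ← sum_add_distrib]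
    refine sum_congr rfl fun k _ => ?_
    rw [Nat.choose_succ_succ]
    push_cast
    ring
  rw [h', hw] at h
  simp only [Nat.choose_zero_succ, Nat.cast_zero, zero_mul, add_zero, mul_one] at h
  linear_combination -h

open Finset in
/-- The generating sum of binomial coefficients at a nontrivial `n`-th root of unity `w`,
expressed recursively through `(1 - w)⁻¹`. -/
lemma sum_choose_succ_mul_pow {n : ℕ} {w : ℂ} (hw : w ^ n = 1) (hw1 : w ≠ 1) (j : ℕ) :
    ∑ k ∈ range n, (k.choose (j + 1) : ℂ) * w ^ k =
      ((1 - w)⁻¹ - 1) * ∑ k ∈ range n, (k.choose j : ℂ) * w ^ k -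
        n.choose (j + 1) * (1 - w)⁻¹ := by
  have h0 : 1 - w ≠ 0 := sub_ne_zero.2 hw1.symm
  have h := one_sub_mul_sum_choose_mul_pow hw j
  have hu : (1 - w)⁻¹ * (1 - w) = 1 := inv_mul_cancel₀ h0
  linear_combination (1 - w)⁻¹ * h - (∑ k ∈ range n, (k.choose (j + 1) : ℂ) * w ^ k +
    ∑ k ∈ range n, (k.choose j : ℂ) * w ^ k) * hu

open Finset in
lemma sum_choose_zero_mul_pow {n : ℕ} {w : ℂ} (hw : w ^ n = 1) (hw1 : w ≠ 1) :
    ∑ k ∈ range n, (k.choose 0 : ℂ) * w ^ k = 0 := by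
  simp [geom_sum_eq hw1, hw]

open Finset in
lemma sum_range_cast_choose (n j : ℕ) :
    ∑ k ∈ range n, (k.choose j : ℂ) = n.choose (j + 1) := by
  induction n with
  | zero => simp
  | succ n ih => rw [sum_range_succ, ih, Nat.choose_succ_succ, Nat.cast_add, add_comm]

lemma cast_choose_succ_mul (n k : ℕ) :
    (n.choose (k + 1) : ℂ) * (k + 1) = n.choose k * (n - k) := by
  rcases le_or_gt k n with h | h
  · have := Nat.choose_succ_right_eq n k
    rw [← Nat.cast_sub h]
    exact_mod_cast this
  · simp [Nat.choose_eq_zero_of_lt h, Nat.choose_eq_zero_of_lt (h.trans (Nat.lt_succ_self k))]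

open Finset in
/-- Orthogonality: summing the binomial generating sum over the nontrivial `n`-th roots of
unity. -/
lemma IsPrimitiveRoot.sum_Icc_sum_choose_mul_pow {n : ℕ} {z : ℂ} (hz : IsPrimitiveRoot z n)
    (hn : 0 < n) (j : ℕ) :
    ∑ i ∈ Icc 1 (n - 1), ∑ k ∈ range n, (k.choose (j + 1) : ℂ) * (z ^ i) ^ k =
      -n.choose (j + 2) := by
  have hall : ∑ i ∈ range n, ∑ k ∈ range n, (k.choose (j + 1) : ℂ) * (z ^ i) ^ k = 0 := by
    rw [sum_comm]
    refine sum_eq_zero fun k hk => ?_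
    rcases Nat.eq_zero_or_pos k with rfl | hk0
    · simp
    · have h1 : z ^ k ≠ 1 := hz.pow_ne_one_of_pos_of_lt hk0.ne' (mem_range.1 hk)
      have h2 : (z ^ k) ^ n = 1 := by rw [← pow_mul, mul_comm, pow_mul, hz.pow_eq_one, one_pow]
      simp_rw [← mul_sum, ← pow_mul, mul_comm _ k, pow_mul]
      rw [geom_sum_eq h1, h2, sub_self, zero_div, mul_zero]
  have hset : range n = insert 0 (Icc 1 (n - 1)) := by
    ext i
    simp only [mem_range, mem_insert, mem_Icc]
    omega
  have hsplit : ∀ f : ℕ → ℂ, ∑ i ∈ range n, f i = f 0 + ∑ i ∈ Icc 1 (n - 1), f i := by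
    intro f
    rw [hset, sum_insert (by simp)]
  rw [hsplit] at hall
  simp only [pow_zero, one_pow, mul_one, sum_range_cast_choose] at hall
  linear_combination hall

open Finset in
lemma IsPrimitiveRoot.sum_inv_one_sub_pow_four {n : ℕ} {z : ℂ} (hz : IsPrimitiveRoot z n)
    (hn : 0 < n) :
    ∑ i ∈ Icc 1 (n - 1), ((1 - z ^ i) ^ 4)⁻¹ =
      ((n : ℂ) - 1) * ((n : ℂ) ^ 3 + (n : ℂ) ^ 2 - 109 * (n : ℂ) + 251) / 720 := by
  have hn0 : (n : ℂ) ≠ 0 := Nat.cast_ne_zero.2 hn.ne'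
  have hroot : ∀ i ∈ Icc 1 (n - 1), (z ^ i) ^ n = 1 ∧ z ^ i ≠ 1 := by
    intro i hi
    rw [mem_Icc] at hi
    refine ⟨?_, hz.pow_ne_one_of_pos_of_lt (by omega) (by omega)⟩
    rw [← pow_mul, mul_comm, pow_mul, hz.pow_eq_one, one_pow]
  have c1 : (n.choose 1 : ℂ) = n := by simp
  have c2 : (n.choose 2 : ℂ) = n * (n - 1) / 2 := by
    have := cast_choose_succ_mul n 1
    push_cast at this
    linear_combination this / 2 + (n - 1) / 2 * c1
  have c3 : (n.choose 3 : ℂ) = n * (n - 1) * (n - 2) / 6 := by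
    have := cast_choose_succ_mul n 2
    push_cast at this
    linear_combination this / 3 + (n - 2) / 3 * c2
  have c4 : (n.choose 4 : ℂ) = n * (n - 1) * (n - 2) * (n - 3) / 24 := by
    have := cast_choose_succ_mul n 3
    push_cast at this
    linear_combination this / 4 + (n - 3) / 4 * c3
  have c5 : (n.choose 5 : ℂ) = n * (n - 1) * (n - 2) * (n - 3) * (n - 4) / 120 := by
    have := cast_choose_succ_mul n 4
    push_cast at this
    linear_combination this / 5 + (n - 4) / 5 * c4
  set p : ℕ → ℂ := fun s => ∑ i ∈ Icc 1 (n - 1), ((1 - z ^ i)⁻¹) ^ s with hp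
  have e1 : -(n : ℂ) * p 1 = -n.choose 2 := by
    rw [← hz.sum_Icc_sum_choose_mul_pow hn 0, hp]
    simp only [mul_sum]
    refine sum_congr rfl fun i hi => ?_
    obtain ⟨h, h1⟩ := hroot i hi
    rw [sum_choose_succ_mul_pow h h1, sum_choose_zero_mul_pow h h1, c1]
    ring
  have e2 : -(n : ℂ) * p 2 + (n - n.choose 2) * p 1 = -n.choose 3 := by
    rw [← hz.sum_Icc_sum_choose_mul_pow hn 1, hp]
    simp only [mul_sum, ← sum_add_distrib]
    refine sum_congr rfl fun i hi => ?_
    obtain ⟨h, h1⟩ := hroot i hi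
    rw [sum_choose_succ_mul_pow h h1, sum_choose_succ_mul_pow h h1,
      sum_choose_zero_mul_pow h h1, c1]
    ring
  have e3 : -(n : ℂ) * p 3 + (2 * n - n.choose 2) * p 2 +
      (-n + n.choose 2 - n.choose 3) * p 1 = -n.choose 4 := by
    rw [← hz.sum_Icc_sum_choose_mul_pow hn 2, hp]
    simp only [mul_sum, ← sum_add_distrib]
    refine sum_congr rfl fun i hi => ?_
    obtain ⟨h, h1⟩ := hroot i hi
    rw [sum_choose_succ_mul_pow h h1, sum_choose_succ_mul_pow h h1,
      sum_choose_succ_mul_pow h h1, sum_choose_zero_mul_pow h h1, c1]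
    ring
  have e4 : -(n : ℂ) * p 4 + (3 * n - n.choose 2) * p 3 +
      (-3 * n + 2 * n.choose 2 - n.choose 3) * p 2 +
      (n - n.choose 2 + n.choose 3 - n.choose 4) * p 1 = -n.choose 5 := by
    rw [← hz.sum_Icc_sum_choose_mul_pow hn 3, hp]
    simp only [mul_sum, ← sum_add_distrib]
    refine sum_congr rfl fun i hi => ?_
    obtain ⟨h, h1⟩ := hroot i hi
    rw [sum_choose_succ_mul_pow h h1, sum_choose_succ_mul_pow h h1,
      sum_choose_succ_mul_pow h h1, sum_choose_succ_mul_pow h h1,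
      sum_choose_zero_mul_pow h h1, c1]
    ring
  rw [c2] at e1
  rw [c2, c3] at e2
  rw [c2, c3, c4] at e3
  rw [c2, c3, c4, c5] at e4
  have p1 : p 1 = (n - 1) / 2 := mul_left_cancel₀ hn0 (by linear_combination -e1)
  rw [p1] at e2 e3 e4
  have p2 : p 2 = -((n : ℂ) - 1) * (n - 5) / 12 :=
    mul_left_cancel₀ hn0 (by linear_combination -e2)
  rw [p2] at e3 e4
  have p3 : p 3 = -((n : ℂ) - 1) * (n - 3) / 8 :=
    mul_left_cancel₀ hn0 (by linear_combination -e3)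
  rw [p3] at e4
  have p4 : p 4 = ((n : ℂ) - 1) * ((n : ℂ) ^ 3 + (n : ℂ) ^ 2 - 109 * (n : ℂ) + 251) / 720 :=
    mul_left_cancel₀ hn0 (by linear_combination -e4)
  rw [← p4, hp]
  simp only [inv_pow]

theorem stmt7 (n : ℕ) (hn : 2 ≤ n) :
    zmzv n 1 4 = ∑ i ∈ Finset.Icc 1 (n - 1), ((1 - zetaN n ^ i) ^ 4)⁻¹ ∧
    ∑ i ∈ Finset.Icc 1 (n - 1), ((1 - zetaN n ^ i) ^ 4)⁻¹ =
      ((n : ℂ) - 1) * ((n : ℂ) ^ 3 + (n : ℂ) ^ 2 - 109 * (n : ℂ) + 251) / 720 := by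
  refine ⟨?_, (Complex.isPrimitiveRoot_exp n (by omega)).sum_inv_one_sub_pow_four (by omega)⟩
  simp [zmzv, Finset.powersetCard_one]
end

section
/- Let n ≥ 2 be an integer and let ζ_n = exp(2πi/n). Then 𝔷_n(ζ_n; 1, 5) = ∑_{i=1}^{n−1} 1/(1−ζ_n^{i})^{5} = (n−1)(n−5)(n^2+6n−19)/288. -/
/-- The twisted power sum `∑_{i=1}^{n-1} ζ^{i(k+1)} / (1 - ζ^i)^s`. -/
noncomputable def twistedSum (ζ : ℂ) (n s k : ℕ) : ℂ :=
  ∑ i ∈ Finset.Icc 1 (n - 1), (ζ ^ i) ^ (k + 1) * ((1 - ζ ^ i) ^ s)⁻¹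

/-- The hockey-stick identity, with the upper index running over `Finset.range n`. -/
theorem Nat.sum_range_choose_eq_choose_succ (n j : ℕ) :
    ∑ k ∈ Finset.range n, k.choose j = n.choose (j + 1) := by
  induction n with
  | zero => simp
  | succ n ih => rw [Finset.sum_range_succ, ih, Nat.choose_succ_succ, add_comm]

section

variable {ζ : ℂ} {n : ℕ}

theorem IsPrimitiveRoot.one_sub_pow_ne_zero (hζ : IsPrimitiveRoot ζ n) {i : ℕ}
    (hi : i ∈ Finset.Icc 1 (n - 1)) : 1 - ζ ^ i ≠ 0 := by
  rw [Finset.mem_Icc] at hi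
  exact sub_ne_zero.mpr (hζ.pow_ne_one_of_pos_of_lt (by omega) (by omega)).symm

theorem IsPrimitiveRoot.sum_pow_pow_eq_zero (hζ : IsPrimitiveRoot ζ n) {i : ℕ}
    (hi : ζ ^ i ≠ 1) : ∑ k ∈ Finset.range n, (ζ ^ i) ^ k = 0 := by
  rw [geom_sum_eq hi, pow_right_comm, hζ.pow_eq_one, one_pow, sub_self, zero_div]

theorem sum_twistedSum_eq_zero (hζ : IsPrimitiveRoot ζ n) (s : ℕ) :
    ∑ k ∈ Finset.range n, twistedSum ζ n s k = 0 := by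
  unfold twistedSum
  rw [Finset.sum_comm]
  refine Finset.sum_eq_zero fun i hi => ?_
  have h1 : ζ ^ i ≠ 1 := fun h => hζ.one_sub_pow_ne_zero hi (by rw [h, sub_self])
  simp_rw [pow_succ]
  rw [← Finset.sum_mul, ← Finset.sum_mul, hζ.sum_pow_pow_eq_zero h1, zero_mul, zero_mul]

theorem twistedSum_succ_right (hζ : IsPrimitiveRoot ζ n) (s k : ℕ) :
    twistedSum ζ n (s + 1) (k + 1) = twistedSum ζ n (s + 1) k - twistedSum ζ n s k := by
  unfold twistedSum
  rw [← Finset.sum_sub_distrib]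
  refine Finset.sum_congr rfl fun i hi => ?_
  have h := hζ.one_sub_pow_ne_zero hi
  field_simp
  ring

theorem twistedSum_zero_left (hζ : IsPrimitiveRoot ζ n) {k : ℕ} (hk : k + 1 < n) :
    twistedSum ζ n 0 k = -1 := by
  have h := hζ.sum_pow_pow_eq_zero (hζ.pow_ne_one_of_pos_of_lt (Nat.succ_ne_zero k) hk)
  obtain ⟨m, rfl⟩ : ∃ m, n = m + 1 := ⟨n - 1, by omega⟩
  rw [Finset.sum_range_succ', pow_zero] at h
  rw [eq_neg_iff_add_eq_zero, ← h, twistedSum, Nat.add_sub_cancel,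
    Finset.range_eq_Ico, Finset.sum_Ico_add' (fun j => (ζ ^ k.succ) ^ j) 0 m 1, zero_add,
    Finset.Ico_add_one_right_eq_Icc]
  simp [pow_right_comm]

/-- Newton's forward difference formula for `k ↦ twistedSum ζ n s k`. -/
theorem twistedSum_eq_sum_choose (hζ : IsPrimitiveRoot ζ n) (s k : ℕ) (hk : k + 1 < n + s) :
    twistedSum ζ n s k =
      ∑ j ∈ Finset.range (s + 1), (-1) ^ j * (k.choose j : ℂ) * twistedSum ζ n (s - j) 0 := by
  induction s generalizing k with
  | zero =>
    rw [twistedSum_zero_left hζ hk]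
    simp [twistedSum_zero_left hζ (k := 0) (by omega)]
  | succ s ihs =>
    induction k with
    | zero => simp [Finset.sum_range_succ']
    | succ k ihk =>
      rw [twistedSum_succ_right hζ, ihk (by omega), ihs k (by omega),
        Finset.sum_range_succ' _ (s + 1), Finset.sum_range_succ' _ (s + 1), add_sub_right_comm,
        ← Finset.sum_sub_distrib]
      congr 1
      · refine Finset.sum_congr rfl fun j _ => ?_
        rw [Nat.choose_succ_succ, Nat.add_sub_add_right]
        push_cast
        ring
      · simp

theorem sum_choose_mul_twistedSum_eq_zero (hζ : IsPrimitiveRoot ζ n) {s : ℕ} (hs : s ≠ 0) :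
    ∑ j ∈ Finset.range (s + 1), (-1) ^ j * (n.choose (j + 1) : ℂ) * twistedSum ζ n (s - j) 0 =
      0 := by
  rw [← sum_twistedSum_eq_zero hζ s, Finset.sum_congr rfl fun k hk =>
    twistedSum_eq_sum_choose hζ s k (by rw [Finset.mem_range] at hk; omega), Finset.sum_comm]
  refine Finset.sum_congr rfl fun j _ => ?_
  rw [← Finset.sum_mul, ← Finset.mul_sum, ← Nat.cast_sum, Nat.sum_range_choose_eq_choose_succ]

theorem sum_inv_one_sub_pow_succ (hζ : IsPrimitiveRoot ζ n) (s : ℕ) :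
    ∑ i ∈ Finset.Icc 1 (n - 1), ((1 - ζ ^ i) ^ (s + 1))⁻¹ =
      ∑ i ∈ Finset.Icc 1 (n - 1), ((1 - ζ ^ i) ^ s)⁻¹ + twistedSum ζ n (s + 1) 0 := by
  rw [twistedSum, ← Finset.sum_add_distrib]
  refine Finset.sum_congr rfl fun i hi => ?_
  have h := hζ.one_sub_pow_ne_zero hi
  field_simp
  ring

end

theorem Nat.cast_choose_succ_eq {K : Type*} [Field K] [CharZero K] (n j : ℕ) :
    (n.choose (j + 1) : K) = n.choose j * (n - j) / (j + 1) := by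
  rw [eq_div_iff (Nat.cast_add_one_ne_zero j)]
  rcases le_or_gt j n with h | h
  · rw [← Nat.cast_sub h]
    exact_mod_cast Nat.choose_succ_right_eq n j
  · simp [Nat.choose_eq_zero_of_lt h, Nat.choose_eq_zero_of_lt (h.trans (Nat.lt_succ_self j))]

theorem IsPrimitiveRoot.sum_inv_one_sub_pow_five {ζ : ℂ} {n : ℕ} (hζ : IsPrimitiveRoot ζ n)
    (hn : 2 ≤ n) :
    ∑ i ∈ Finset.Icc 1 (n - 1), ((1 - ζ ^ i) ^ 5)⁻¹ =
      ((n : ℂ) - 1) * ((n : ℂ) - 5) * ((n : ℂ) ^ 2 + 6 * (n : ℂ) - 19) / 288 := by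
  have hn0 : (n : ℂ) ≠ 0 := Nat.cast_ne_zero.mpr (by omega)
  have a₀ : twistedSum ζ n 0 0 = -1 := twistedSum_zero_left hζ (by omega)
  have e₁ := sum_choose_mul_twistedSum_eq_zero hζ one_ne_zero
  have e₂ := sum_choose_mul_twistedSum_eq_zero hζ two_ne_zero
  have e₃ := sum_choose_mul_twistedSum_eq_zero hζ three_ne_zero
  have e₄ := sum_choose_mul_twistedSum_eq_zero hζ four_ne_zero
  have e₅ := sum_choose_mul_twistedSum_eq_zero hζ (show 5 ≠ 0 by norm_num)
  simp [Finset.sum_range_succ, Nat.cast_choose_succ_eq, a₀] at e₁ e₂ e₃ e₄ e₅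
  have a₁ : twistedSum ζ n 1 0 = (1 - n) / 2 := by
    apply mul_left_cancel₀ hn0
    linear_combination e₁
  rw [a₁] at e₂ e₃ e₄ e₅
  have a₂ : twistedSum ζ n 2 0 = (1 - n ^ 2) / 12 := by
    apply mul_left_cancel₀ hn0
    linear_combination e₂
  rw [a₂] at e₃ e₄ e₅
  have a₃ : twistedSum ζ n 3 0 = (1 - n ^ 2) / 24 := by
    apply mul_left_cancel₀ hn0
    linear_combination e₃
  rw [a₃] at e₄ e₅
  have a₄ : twistedSum ζ n 4 0 = (19 - 20 * n ^ 2 + n ^ 4) / 720 := by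
    apply mul_left_cancel₀ hn0
    linear_combination e₄
  rw [a₄] at e₅
  have a₅ : twistedSum ζ n 5 0 = (9 - 10 * n ^ 2 + n ^ 4) / 480 := by
    apply mul_left_cancel₀ hn0
    linear_combination e₅
  simp only [sum_inv_one_sub_pow_succ hζ, zero_add, a₁, a₂, a₃, a₄, a₅, pow_zero, inv_one,
    Finset.sum_const, Nat.card_Icc, Nat.add_sub_cancel, nsmul_eq_mul, mul_one]
  push_cast [Nat.cast_sub (show 1 ≤ n by omega)]
  ring

theorem stmt8 (n : ℕ) (hn : 2 ≤ n) :
    zmzv n 1 5 = ∑ i ∈ Finset.Icc 1 (n - 1), ((1 - zetaN n ^ i) ^ 5)⁻¹ ∧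
    ∑ i ∈ Finset.Icc 1 (n - 1), ((1 - zetaN n ^ i) ^ 5)⁻¹ =
      ((n : ℂ) - 1) * ((n : ℂ) - 5) * ((n : ℂ) ^ 2 + 6 * (n : ℂ) - 19) / 288 := by
  have hζ : IsPrimitiveRoot (zetaN n) n := Complex.isPrimitiveRoot_exp n (by omega)
  exact ⟨by simp [zmzv, Finset.powersetCard_one], hζ.sum_inv_one_sub_pow_five hn⟩
end

section
/- Let n ≥ 2 and m ≥ 1 be integers and let ζ_n = exp(2πi/n). For 0 ≤ k ≤ m, let e_k = ∑_{m+1 ≤ i_1 < ⋯ < i_{m−k} ≤ 2m+1} i_1 i_2 ⋯ i_{m−k} denote the elementary symmetric sum of degree m−k of the integers m+1, m+2, …, 2m+1 (with the empty product e_m = 1); these are the (m+1)-Stirling numbers of the first kind [2m+2, m+k+2]_{m+1}. Then 𝔷_n(ζ_n; m, 2) = (2·m!/(2m+2)!) · C(n−1, m) · ∑_{k=0}^{m} e_k · (−n)^k. -/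
open Polynomial in
theorem coeff_prod_one_add_C_mul_X_pow {ι R : Type*} [CommRing R] (s : Finset ι)
    (c : ι → R) {d : ℕ} (hd : 0 < d) (k : ℕ) :
    (∏ i ∈ s, (1 + C (c i) * X ^ d)).coeff (d * k) =
      ∑ T ∈ s.powersetCard k, ∏ i ∈ T, c i := by
  rw [Finset.prod_one_add, finsetSum_coeff, Finset.powersetCard_eq_filter,
    Finset.sum_filter]
  refine Finset.sum_congr rfl fun T _ => ?_
  rw [Finset.prod_mul_distrib, Finset.prod_const, ← pow_mul, ← map_prod, coeff_C_mul, coeff_X_pow]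
  have : d * k = d * T.card ↔ T.card = k := by
    rw [Nat.mul_right_inj hd.ne', eq_comm]
  simp [this]

open Polynomial in
theorem coeff_one_add_C_mul_X_pow_pow {R : Type*} [CommRing R] (c : R) {d : ℕ} (hd : 0 < d)
    (n k : ℕ) : ((1 + C c * X ^ d) ^ n).coeff (d * k) = n.choose k * c ^ k := by
  have h := coeff_prod_one_add_C_mul_X_pow (Finset.range n) (fun _ => c) hd k
  rw [Finset.prod_const, Finset.card_range] at h
  rw [h, Finset.sum_congr rfl fun T hT => by
    rw [Finset.prod_const, (Finset.mem_powersetCard.1 hT).2]]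
  simp

theorem isPrimitiveRoot_zetaN {n : ℕ} (hn : n ≠ 0) : IsPrimitiveRoot (zetaN n) n :=
  Complex.isPrimitiveRoot_exp n hn

theorem prod_range_eq_mul_prod_Icc {M : Type*} [CommMonoid M] {n : ℕ} (hn : 0 < n) (f : ℕ → M) :
    ∏ i ∈ Finset.range n, f i = f 0 * ∏ i ∈ Finset.Icc 1 (n - 1), f i := by
  rw [Finset.range_eq_Ico, Finset.prod_eq_prod_Ico_succ_bot hn]
  rw [zero_add, ← Finset.Ico_add_one_right_eq_Icc, Nat.sub_add_cancel (show 1 ≤ n from hn)]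

theorem one_sub_zetaN_pow_ne_zero {n i : ℕ} (hi : i ∈ Finset.Icc 1 (n - 1)) :
    1 - zetaN n ^ i ≠ 0 := by
  rw [Finset.mem_Icc] at hi
  exact sub_ne_zero.2 (Ne.symm ((isPrimitiveRoot_zetaN (by omega)).pow_ne_one_of_pos_of_lt
    (by omega) (by omega)))

open Polynomial in
/-- `T · ∏ (1 - ζ ^ i + T) = (1 + T) ^ n - 1`, for `T` in any commutative `ℂ`-algebra. -/
theorem mul_prod_one_sub_zetaN_pow_add {A : Type*} [CommRing A] [Algebra ℂ A] {n : ℕ} (hn : 0 < n)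
    (T : A) :
    T * ∏ i ∈ Finset.Icc 1 (n - 1), (algebraMap ℂ A (1 - zetaN n ^ i) + T) = (1 + T) ^ n - 1 := by
  have h := X_pow_sub_C_eq_prod (isPrimitiveRoot_zetaN hn.ne') hn (one_pow n : (1 : ℂ) ^ n = 1)
  have h' := congrArg (aeval (1 + T)) h
  rw [prod_range_eq_mul_prod_Icc hn] at h'
  simp only [map_sub, map_mul, map_prod, map_pow, aeval_X, aeval_C, mul_one, pow_zero, map_one,
    add_sub_cancel_left] at h'
  rw [h']
  congr 1
  refine Finset.prod_congr rfl fun i _ => ?_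
  rw [map_sub, map_one, map_pow]
  ring

theorem prod_one_sub_zetaN_pow {n : ℕ} (hn : 0 < n) :
    ∏ i ∈ Finset.Icc 1 (n - 1), (1 - zetaN n ^ i) = n := by
  obtain ⟨k, rfl⟩ : ∃ k, n = k + 1 := ⟨n - 1, by omega⟩
  have h := (isPrimitiveRoot_zetaN hn.ne').prod_one_sub_pow_eq_order
  rw [Nat.add_sub_cancel, ← Finset.Ico_add_one_right_eq_Icc, Finset.prod_Ico_eq_prod_range,
    Nat.add_sub_cancel]
  simpa [add_comm] using h

open Polynomial in
theorem sq_mul_X_sq_mul_prod {n : ℕ} (hn : 0 < n) :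
    C ((n : ℂ) ^ 2) * ((∏ i ∈ Finset.Icc 1 (n - 1),
        (1 + C (-((1 - zetaN n ^ i) ^ 2)⁻¹) * X ^ 2)) * X ^ 2) =
      (1 + C 1 * X ^ 1) ^ n + (1 + C (-1) * X ^ 1) ^ n - (1 + C (-1) * X ^ 2) ^ n - 1 := by
  have h₁ := mul_prod_one_sub_zetaN_pow_add hn (X : ℂ[X])
  have h₂ := mul_prod_one_sub_zetaN_pow_add hn (-X : ℂ[X])
  have h₃ : C ((n : ℂ) ^ 2) * (∏ i ∈ Finset.Icc 1 (n - 1),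
        (1 + C (-((1 - zetaN n ^ i) ^ 2)⁻¹) * X ^ 2)) =
      (∏ i ∈ Finset.Icc 1 (n - 1), (algebraMap ℂ ℂ[X] (1 - zetaN n ^ i) + X)) *
      ∏ i ∈ Finset.Icc 1 (n - 1), (algebraMap ℂ ℂ[X] (1 - zetaN n ^ i) + -X) := by
    rw [← prod_one_sub_zetaN_pow hn, ← Finset.prod_pow, map_prod, ← Finset.prod_mul_distrib,
      ← Finset.prod_mul_distrib]
    refine Finset.prod_congr rfl fun i hi => ?_
    have hc : C ((1 - zetaN n ^ i) ^ 2) * C (((1 - zetaN n ^ i) ^ 2)⁻¹) = 1 := by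
      rw [← C_mul, mul_inv_cancel₀ (pow_ne_zero 2 (one_sub_zetaN_pow_ne_zero hi)), C_1]
    rw [algebraMap_eq, C_neg]
    rw [mul_add, mul_one, neg_mul, mul_neg, ← mul_assoc, hc, C_pow]
    ring
  rw [← mul_assoc, h₃]
  have h₄ : (1 + C (-1) * X ^ 2 : ℂ[X]) ^ n = (1 + X) ^ n * (1 + -X) ^ n := by
    rw [← mul_pow, C_neg, C_1]
    ring
  rw [h₄, C_neg, C_1, pow_one, one_mul, neg_one_mul]
  linear_combination
    (X * ∏ i ∈ Finset.Icc 1 (n - 1), (algebraMap ℂ ℂ[X] (1 - zetaN n ^ i) + -X)) * h₁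
    - ((1 + X) ^ n - 1) * h₂

open Polynomial in
theorem sq_mul_zmzv_two {n : ℕ} (hn : 0 < n) (m : ℕ) :
    (n : ℂ) ^ 2 * zmzv n m 2 =
      n.choose (m + 1) + 2 * (-1) ^ m * n.choose (2 * m + 2) := by
  have h := congrArg (fun p => coeff p (2 * m + 2)) (sq_mul_X_sq_mul_prod hn)
  have h₁ := fun c : ℂ => coeff_one_add_C_mul_X_pow_pow c one_pos n (2 * m + 2)
  have h₂ := coeff_one_add_C_mul_X_pow_pow (-1 : ℂ) two_pos n (m + 1)
  rw [one_mul] at h₁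
  rw [mul_add, mul_one] at h₂
  simp only [coeff_C_mul, coeff_mul_X_pow, coeff_sub, coeff_add, h₁, h₂,
    coeff_prod_one_add_C_mul_X_pow _ _ two_pos, coeff_one] at h
  have h₃ : ∑ T ∈ (Finset.Icc 1 (n - 1)).powersetCard m,
      ∏ i ∈ T, (-((1 - zetaN n ^ i) ^ 2)⁻¹) = (-1) ^ m * zmzv n m 2 := by
    rw [zmzv, Finset.mul_sum]
    refine Finset.sum_congr rfl fun T hT => ?_
    rw [Finset.prod_neg, (Finset.mem_powersetCard.1 hT).2, Finset.prod_inv_distrib]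
  have h₄ : ((-1 : ℂ) ^ m) * (-1) ^ m = 1 := by rw [← mul_pow]; simp
  have h₅ : ((-1 : ℂ) ^ (2 * m + 2)) = 1 := Even.neg_one_pow ⟨m + 1, by ring⟩
  rw [h₃, h₅, if_neg (by omega), one_pow, pow_succ] at h
  linear_combination (-1) ^ m * h - ((n : ℂ) ^ 2 * zmzv n m 2 - n.choose (m + 1)) * h₄

open Polynomial in
/-- The generating polynomial of the elementary symmetric sums of all degrees but the top one. -/
theorem mul_sum_esymm_mul_pow {R : Type*} [CommRing R] (s : Finset ℕ) {m : ℕ}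
    (hs : s.card = m + 1) (z : R) :
    z * ∑ k ∈ Finset.range (m + 1),
        (∑ T ∈ s.powersetCard (m - k), ∏ i ∈ T, (i : R)) * z ^ k =
      ∏ i ∈ s, (z + i) - ∏ i ∈ s, (i : R) := by
  nontriviality R
  have hp : (∏ i ∈ s, (z + i)) = (∏ i ∈ s, (X + C (i : R))).eval z := by
    simp [eval_prod]
  have hd : (∏ i ∈ s, (X + C (i : R))).natDegree = m + 1 := by
    rw [natDegree_prod_of_monic _ _ fun i _ => monic_X_add_C _]
    simp only [natDegree_X_add_C, Finset.sum_const, hs, smul_eq_mul, mul_one]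
  rw [hp, eval_eq_sum_range, hd, Finset.sum_range_succ' _ (m + 1),
    Finset.prod_X_add_C_coeff _ _ (Nat.zero_le _), Nat.sub_zero, Finset.powersetCard_self,
    Finset.sum_singleton, pow_zero, mul_one,
    add_sub_cancel_right, Finset.mul_sum]
  refine Finset.sum_congr rfl fun k hk => ?_
  rw [Finset.mem_range] at hk
  rw [Finset.prod_X_add_C_coeff _ _ (by omega), hs, Nat.add_sub_add_right, pow_succ]
  ring

theorem prod_range_cast_sub (n k : ℕ) :
    ∏ j ∈ Finset.range k, ((n : ℂ) - j) = k.factorial * n.choose k := by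
  rw [← descPochhammer_eval_eq_prod_range, descPochhammer_eval_eq_descFactorial,
    Nat.descFactorial_eq_factorial_mul_choose]
  push_cast
  rfl

theorem prod_Icc_neg_add_cast {n : ℕ} (hn : 0 < n) (m : ℕ) :
    (n : ℂ) * (m.factorial * (n - 1).choose m) *
        ∏ j ∈ Finset.Icc (m + 1) (2 * m + 1), (-(n : ℂ) + j) =
      (-1) ^ (m + 1) * ((2 * m + 2).factorial * n.choose (2 * m + 2)) := by
  have h₁ : ∏ j ∈ Finset.Icc (m + 1) (2 * m + 1), (-(n : ℂ) + j) =
      (-1) ^ (m + 1) * ∏ j ∈ Finset.range (m + 1), ((n : ℂ) - ((m + 1 + j : ℕ) : ℂ)) := by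
    rw [← Finset.Ico_add_one_right_eq_Icc, Finset.prod_Ico_eq_prod_range,
      show 2 * m + 1 + 1 - (m + 1) = m + 1 by omega]
    have hneg := Finset.prod_neg (s := Finset.range (m + 1))
      (f := fun j => (n : ℂ) - ((m + 1 + j : ℕ) : ℂ))
    rw [Finset.card_range] at hneg
    rw [← hneg]
    exact Finset.prod_congr rfl fun j _ => by ring
  have h₂ : (n : ℂ) * (m.factorial * (n - 1).choose m) =
      ∏ j ∈ Finset.range (m + 1), ((n : ℂ) - j) := by
    rw [prod_range_cast_sub]
    obtain ⟨k, rfl⟩ : ∃ k, n = k + 1 := ⟨n - 1, by omega⟩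
    have := Nat.add_one_mul_choose_eq k m
    rw [Nat.add_sub_cancel, Nat.factorial_succ]
    have h : ((k + 1 : ℕ) : ℂ) * k.choose m = (k + 1).choose (m + 1) * (m + 1 : ℕ) :=
      mod_cast this
    push_cast at h ⊢
    linear_combination (m.factorial : ℂ) * h
  rw [h₁, h₂, ← prod_range_cast_sub, show 2 * m + 2 = (m + 1) + (m + 1) by ring,
    Finset.prod_range_add _ (m + 1)]
  ac_rfl

theorem prod_Icc_cast_mul_factorial (m : ℕ) :
    (m.factorial : ℂ) * ∏ j ∈ Finset.Icc (m + 1) (2 * m + 1), (j : ℂ) = (2 * m + 1).factorial := by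
  rw [← Nat.cast_prod, ← Nat.cast_mul]
  congr 1
  rw [← Finset.prod_Ico_id_eq_factorial, ← Finset.prod_Ico_id_eq_factorial,
    ← Finset.Ico_add_one_right_eq_Icc]
  exact Finset.prod_Ico_consecutive _ (by omega) (by omega)

theorem stmt10 (n m : ℕ) (hn : 2 ≤ n) (hm : 1 ≤ m) :
    zmzv n m 2 =
      (2 * (Nat.factorial m : ℂ) / (Nat.factorial (2 * m + 2) : ℂ)) *
        ((n - 1).choose m : ℂ) *
        ∑ k ∈ Finset.range (m + 1),
          (∑ T ∈ (Finset.Icc (m + 1) (2 * m + 1)).powersetCard (m - k),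
            ∏ i ∈ T, (i : ℂ)) * (-(n : ℂ)) ^ k := by
  have hn₀ : 0 < n := by omega
  have hnC : (n : ℂ) ≠ 0 := Nat.cast_ne_zero.2 hn₀.ne'
  have hz := sq_mul_zmzv_two hn₀ m
  have hS := mul_sum_esymm_mul_pow (Finset.Icc (m + 1) (2 * m + 1)) (m := m)
    (by rw [Nat.card_Icc]; omega) (-(n : ℂ))
  have hP := prod_Icc_neg_add_cast hn₀ m
  have hF := prod_Icc_cast_mul_factorial m
  have hC : (n : ℂ) * (n - 1).choose m = n.choose (m + 1) * (m + 1) := by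
    obtain ⟨k, rfl⟩ : ∃ k, n = k + 1 := ⟨n - 1, by omega⟩
    exact mod_cast Nat.add_one_mul_choose_eq k m
  have hfac : ((2 * m + 2).factorial : ℂ) = (2 * m + 2) * (2 * m + 1).factorial := by
    rw [Nat.factorial_succ (2 * m + 1)]
    push_cast
    ring
  have hf₀ : ((2 * m + 2).factorial : ℂ) ≠ 0 := Nat.cast_ne_zero.2 (Nat.factorial_ne_zero _)
  set S := ∑ k ∈ Finset.range (m + 1),
          (∑ T ∈ (Finset.Icc (m + 1) (2 * m + 1)).powersetCard (m - k),
            ∏ i ∈ T, (i : ℂ)) * (-(n : ℂ)) ^ k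
  rw [div_mul_eq_mul_div, div_mul_eq_mul_div, eq_div_iff hf₀]
  refine mul_left_cancel₀ (pow_ne_zero 2 hnC) ?_
  rw [pow_succ] at hP
  linear_combination ((2 * m + 2).factorial : ℂ) * hz + 2 * m.factorial * (n - 1).choose m * n * hS
    + 2 * hP - 2 * (n : ℂ) * (n - 1).choose m * hF - 2 * (2 * m + 1).factorial * hC
    + n.choose (m + 1) * hfac
end
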